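/- Let u : ℝ × ℝ → ℂ be a smooth function of (x,t) satisfying equation (GNLS2): u_{tx} + u − 2i·u_x − u_{xx} + i·|u|²·u_x = 0 on ℝ². Then the conservation law ∂_t(|u_x|²) = ∂_x(|u_x|² − |u|²) holds at every point of ℝ², where |u_x|² = u_x·conj(u_x) and |u|² = u·conj(u). -/

import Mathlib

open Complex

/-- Partial derivative in the first (space) variable. -/
noncomputable def dX (f : ℝ × ℝ → ℂ) (p : ℝ × ℝ) : ℂ := fderiv ℝ f p (1, 0)

/-- Partial derivative in the second (time) variable. -/
noncomputable def dT (f : ℝ × ℝ → ℂ) (p : ℝ × ℝ) : ℂ := fderiv ℝ f p (0, 1)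

/-- Equation (GNLS2): `u_{tx} + u - 2i u_x - u_{xx} + i |u|² u_x = 0`. -/
def GNLS2 (u : ℝ × ℝ → ℂ) : Prop :=
  ∀ p : ℝ × ℝ, dT (dX u) p + u p - 2 * Complex.I * dX u p - dX (dX u) p
    + Complex.I * (u p * (starRingEnd ℂ) (u p)) * dX u p = 0

/-- Product rule for the squared modulus along an arbitrary direction. -/
theorem fderiv_mul_conj_apply {E : Type*} [NormedAddCommGroup E] [NormedSpace ℝ E]
    {f : E → ℂ} {p : E} (hf : DifferentiableAt ℝ f p) (v : E) :
    fderiv ℝ (fun q => f q * (starRingEnd ℂ) (f q)) p v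
      = fderiv ℝ f p v * (starRingEnd ℂ) (f p) + f p * (starRingEnd ℂ) (fderiv ℝ f p v) := by
  have hconj : HasFDerivAt (fun q => (starRingEnd ℂ) (f q))
      ((conjCLE : ℂ →L[ℝ] ℂ).comp (fderiv ℝ f p)) p :=
    (conjCLE : ℂ →L[ℝ] ℂ).hasFDerivAt.comp p hf.hasFDerivAt
  rw [(hf.hasFDerivAt.fun_mul hconj).fderiv]
  simp
  ring

/-- The squared modulus of a differentiable function is differentiable. -/
theorem DifferentiableAt.mul_conj_self {E : Type*} [NormedAddCommGroup E] [NormedSpace ℝ E]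
    {f : E → ℂ} {p : E} (hf : DifferentiableAt ℝ f p) :
    DifferentiableAt ℝ (fun q => f q * (starRingEnd ℂ) (f q)) p :=
  hf.mul ((conjCLE : ℂ →L[ℝ] ℂ).differentiableAt.comp p hf)

/-- The conservation law `∂_t(|u_x|²) = ∂_x(|u_x|² - |u|²)`. -/
theorem stmt2 (u : ℝ × ℝ → ℂ) (hu : ContDiff ℝ (⊤ : ℕ∞) u) (hPDE : GNLS2 u) :
    ∀ p : ℝ × ℝ,
      dT (fun q => dX u q * (starRingEnd ℂ) (dX u q)) p
        = dX (fun q => dX u q * (starRingEnd ℂ) (dX u q) - u q * (starRingEnd ℂ) (u q)) p := by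
  intro p
  have hd : DifferentiableAt ℝ u p := hu.differentiable (by simp) p
  have hdX : DifferentiableAt ℝ (dX u) p :=
    (((hu.fderiv_right (m := (⊤ : ℕ∞)) le_rfl).clm_apply
      contDiff_const).differentiable (by simp)) p
  have hp := hPDE p
  have hpc := congrArg (starRingEnd ℂ) hp
  simp only [map_add, map_sub, map_mul, map_zero, conj_I, conj_conj, map_ofNat] at hpc
  have hT : dT (fun q => dX u q * (starRingEnd ℂ) (dX u q)) p
      = dT (dX u) p * (starRingEnd ℂ) (dX u p) + dX u p * (starRingEnd ℂ) (dT (dX u) p) :=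
    fderiv_mul_conj_apply hdX (0, 1)
  have hX : dX (fun q => dX u q * (starRingEnd ℂ) (dX u q) - u q * (starRingEnd ℂ) (u q)) p
      = (dX (dX u) p * (starRingEnd ℂ) (dX u p) + dX u p * (starRingEnd ℂ) (dX (dX u) p))
        - (dX u p * (starRingEnd ℂ) (u p) + u p * (starRingEnd ℂ) (dX u p)) := by
    conv_lhs => rw [dX]
    rw [fderiv_fun_sub hdX.mul_conj_self hd.mul_conj_self, _root_.sub_apply,
      fderiv_mul_conj_apply hdX, fderiv_mul_conj_apply hd]
    rfl
  rw [hT, hX]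
  linear_combination (starRingEnd ℂ) (dX u p) * hp + dX u p * hpc
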